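/- Let M be a finite nonnegative Borel measure on ℝ. Let g : ℕ → ℂ be finitely supported and define F : ℝ → ℂ by F(x) = √2 Σ_{n≥0} g_n L_n^0(2x) e^{-x} for x > 0 and F(x) = 0 for x ≤ 0, where L_n^0 is the Laguerre polynomial with parameter α = 0. Then (2π)^{-1} ∫_ℝ |∫_0^∞ e^{iλx} F(x) dx|² dM(λ) = Σ_{n,m ≥ 0} t_{n−m} g_m conj(g_n), where for k ∈ ℤ, t_k = π^{-1} ∫_ℝ (λ² + 1)^{-1} ((λ − i)/(λ + i))^{-k} dM(λ). In other words, under the unitary map U from ℓ²(ℕ) onto L²((0,∞)) sending the standard basis to the Laguerre basis √2 L_n^0(2x) e^{-x}, the Wiener–Hopf quadratic form of the measure M corresponds to the Toeplitz quadratic form with coefficients t_k. -/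

import Mathlib

open MeasureTheory Set Finset

/-- The generalized Laguerre polynomial
`L_n^α(x) = Σ_{k=0}^n (-1)^k C(n+α, n-k) x^k / k!`. -/
noncomputable def laguerre (α n : ℕ) (x : ℝ) : ℝ :=
  ∑ k ∈ Finset.range (n + 1),
    (-1 : ℝ) ^ k * ((n + α).choose (n - k) : ℝ) * x ^ k / (Nat.factorial k : ℝ)

theorem norm_ofReal_pow_mul_cexp_neg_mul (k : ℕ) (s : ℂ) {x : ℝ} (hx : 0 < x) :
    ‖(x : ℂ) ^ k * Complex.exp (-(s * x))‖ = x ^ (k : ℝ) * Real.exp (-s.re * x) := by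
  rw [norm_mul, norm_pow, Complex.norm_of_nonneg hx.le, Complex.norm_exp, Real.rpow_natCast]
  simp

theorem integrableOn_pow_mul_cexp_neg_mul_Ioi (k : ℕ) {s : ℂ} (hs : 0 < s.re) :
    IntegrableOn (fun x : ℝ => (x : ℂ) ^ k * Complex.exp (-(s * x))) (Ioi 0) := by
  have h := integrableOn_rpow_mul_exp_neg_mul_rpow (s := k) (p := 1) (b := s.re)
    (by linarith [k.cast_nonneg (α := ℝ)]) one_pos hs
  simp only [Real.rpow_one] at h
  refine Integrable.mono' h (Continuous.aestronglyMeasurable (by fun_prop)) ?_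
  filter_upwards [ae_restrict_mem measurableSet_Ioi] with x hx
  exact (norm_ofReal_pow_mul_cexp_neg_mul k s hx).le

theorem tendsto_pow_mul_cexp_neg_mul_atTop (k : ℕ) {s : ℂ} (hs : 0 < s.re) :
    Filter.Tendsto (fun x : ℝ => (x : ℂ) ^ k * Complex.exp (-(s * x))) Filter.atTop (nhds 0) := by
  rw [tendsto_zero_iff_norm_tendsto_zero]
  refine (tendsto_rpow_mul_exp_neg_mul_atTop_nhds_zero k s.re hs).congr' ?_
  filter_upwards [Filter.eventually_gt_atTop 0] with x hx
  exact (norm_ofReal_pow_mul_cexp_neg_mul k s hx).symm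

/-- Laplace transform of a monomial. -/
theorem integral_pow_mul_cexp_neg_mul_Ioi (k : ℕ) {s : ℂ} (hs : 0 < s.re) :
    ∫ x in Ioi (0 : ℝ), (x : ℂ) ^ k * Complex.exp (-(s * x)) =
      (Nat.factorial k : ℂ) / s ^ (k + 1) := by
  have hs0 : s ≠ 0 := fun h => by simp [h] at hs
  induction k with
  | zero =>
    have h := integral_exp_mul_complex_Ioi (a := -s) (by simpa using hs) 0
    simpa using h
  | succ k ih =>
    have hderiv : ∀ x ∈ Ici (0 : ℝ), HasDerivAt
        (fun x : ℝ => (x : ℂ) ^ (k + 1) * Complex.exp (-(s * x)))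
        (((k : ℂ) + 1) * ((x : ℂ) ^ k * Complex.exp (-(s * x))) -
          s * ((x : ℂ) ^ (k + 1) * Complex.exp (-(s * x)))) x := by
      intro x _
      have hx : HasDerivAt (fun x : ℝ => (x : ℂ)) 1 x := Complex.ofRealCLM.hasDerivAt
      refine ((hx.pow (k + 1)).mul (hx.const_mul s).neg.cexp).congr_deriv ?_
      simp only [Pi.pow_apply, Pi.neg_apply, Nat.add_sub_cancel]
      push_cast
      ring
    have hk := (integrableOn_pow_mul_cexp_neg_mul_Ioi k hs).const_mul ((k : ℂ) + 1)
    have hk' := (integrableOn_pow_mul_cexp_neg_mul_Ioi (k + 1) hs).const_mul s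
    have h := integral_Ioi_of_hasDerivAt_of_tendsto' hderiv (hk.sub hk')
      (tendsto_pow_mul_cexp_neg_mul_atTop (k + 1) hs)
    rw [integral_sub hk hk', integral_const_mul, integral_const_mul, ih] at h
    simp only [Complex.ofReal_zero, zero_pow k.succ_ne_zero, zero_mul, sub_zero] at h
    rw [eq_div_iff (pow_ne_zero _ hs0), Nat.factorial_succ]
    have e : ((k : ℂ) + 1) * (Nat.factorial k / s ^ (k + 1)) * s ^ (k + 1) =
        (k + 1) * Nat.factorial k := by
      field_simp
    push_cast
    linear_combination (-s ^ (k + 1)) * h + e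

theorem laguerre_zero_two_mul_mul_cexp (n : ℕ) (s : ℂ) (x : ℝ) :
    (laguerre 0 n (2 * x) : ℂ) * Complex.exp (-(s * x)) =
      ∑ k ∈ Finset.range (n + 1), ((-2 : ℂ) ^ k * (n.choose k : ℂ) / (Nat.factorial k : ℂ)) *
        ((x : ℂ) ^ k * Complex.exp (-(s * x))) := by
  rw [laguerre, Complex.ofReal_sum, Finset.sum_mul]
  refine Finset.sum_congr rfl fun k hk => ?_
  rw [add_zero, Nat.choose_symm (Nat.lt_succ_iff.mp (Finset.mem_range.mp hk)),
    neg_pow (2 : ℂ)]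
  push_cast
  ring

theorem integrableOn_laguerre_mul_cexp_Ioi (n : ℕ) {s : ℂ} (hs : 0 < s.re) :
    IntegrableOn (fun x : ℝ => (laguerre 0 n (2 * x) : ℂ) * Complex.exp (-(s * x))) (Ioi 0) := by
  simp only [laguerre_zero_two_mul_mul_cexp]
  exact integrable_finsetSum _ fun k _ =>
    (integrableOn_pow_mul_cexp_neg_mul_Ioi k hs).const_mul _

/-- Laplace transform of the Laguerre polynomial `L_n(2x)`. -/
theorem integral_laguerre_mul_cexp_Ioi (n : ℕ) {s : ℂ} (hs : 0 < s.re) :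
    ∫ x in Ioi (0 : ℝ), (laguerre 0 n (2 * x) : ℂ) * Complex.exp (-(s * x)) =
      s⁻¹ * (1 - 2 / s) ^ n := by
  have hs0 : s ≠ 0 := fun h => by simp [h] at hs
  simp only [laguerre_zero_two_mul_mul_cexp]
  rw [integral_finsetSum _ fun k _ =>
    (integrableOn_pow_mul_cexp_neg_mul_Ioi k hs).const_mul _]
  rw [show 1 - 2 / s = -2 * s⁻¹ + 1 by ring, add_pow, Finset.mul_sum]
  refine Finset.sum_congr rfl fun k _ => ?_
  rw [integral_const_mul, integral_pow_mul_cexp_neg_mul_Ioi k hs]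
  have : (Nat.factorial k : ℂ) ≠ 0 := by exact_mod_cast k.factorial_ne_zero
  rw [one_pow, mul_pow, inv_pow, pow_succ]
  field_simp

theorem ofReal_add_I_ne_zero (lam : ℝ) : (lam : ℂ) + Complex.I ≠ 0 := fun h => by
  simpa using congrArg Complex.im h

theorem norm_ofReal_sub_I_div_add_I (lam : ℝ) :
    ‖((lam : ℂ) - Complex.I) / ((lam : ℂ) + Complex.I)‖ = 1 := by
  have h : (lam : ℂ) - Complex.I = (starRingEnd ℂ) ((lam : ℂ) + Complex.I) := by
    simp [sub_eq_add_neg]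
  rw [norm_div, h, Complex.norm_conj, div_self (norm_ne_zero_iff.mpr (ofReal_add_I_ne_zero lam))]

/-- Fourier transform of a finite combination of the Laguerre functions. -/
theorem integral_cexp_mul_laguerre_sum (N : ℕ) (g : ℕ → ℂ) (lam : ℝ) :
    ∫ x in Ioi (0 : ℝ), Complex.exp (Complex.I * lam * x) * (if 0 < x then
      (Real.sqrt 2 : ℂ) *
        ∑ n ∈ Finset.range N, g n * (laguerre 0 n (2 * x) : ℂ) * Complex.exp (-x) else 0) =
      (Real.sqrt 2 : ℂ) * (1 - Complex.I * lam)⁻¹ * ∑ n ∈ Finset.range N,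
        g n * (((lam : ℂ) - Complex.I) / ((lam : ℂ) + Complex.I)) ^ n := by
  set s : ℂ := 1 - Complex.I * lam with hs_def
  have hs : 0 < s.re := by simp [hs_def]
  have hs0 : s ≠ 0 := fun h => by simp [h] at hs
  have hw : ((lam : ℂ) - Complex.I) / ((lam : ℂ) + Complex.I) = 1 - 2 / s := by
    have := ofReal_add_I_ne_zero lam
    field_simp
    rw [hs_def]
    linear_combination (2 : ℂ) * lam * Complex.I_sq
  have hint : ∀ x ∈ Ioi (0 : ℝ), Complex.exp (Complex.I * lam * x) * (if 0 < x then
      (Real.sqrt 2 : ℂ) *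
        ∑ n ∈ Finset.range N, g n * (laguerre 0 n (2 * x) : ℂ) * Complex.exp (-x) else 0) =
      ∑ n ∈ Finset.range N, (Real.sqrt 2 * g n : ℂ) *
        ((laguerre 0 n (2 * x) : ℂ) * Complex.exp (-(s * x))) := by
    intro x hx
    rw [if_pos (mem_Ioi.mp hx), Finset.mul_sum, Finset.mul_sum]
    refine Finset.sum_congr rfl fun n _ => ?_
    rw [show -(s * x) = Complex.I * lam * x + -x by rw [hs_def]; ring, Complex.exp_add]
    ring
  rw [setIntegral_congr_fun measurableSet_Ioi hint, integral_finsetSum _ fun n _ =>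
    (integrableOn_laguerre_mul_cexp_Ioi n hs).const_mul _, Finset.mul_sum]
  refine Finset.sum_congr rfl fun n _ => ?_
  rw [integral_const_mul, integral_laguerre_mul_cexp_Ioi n hs, hw]
  ring

theorem integrable_inv_sq_add_one_mul_zpow (M : Measure ℝ) [IsFiniteMeasure M] (k : ℤ) :
    Integrable (fun lam : ℝ => ((lam : ℂ) ^ 2 + 1)⁻¹ *
      (((lam : ℂ) - Complex.I) / ((lam : ℂ) + Complex.I)) ^ k) M := by
  refine Integrable.of_bound (C := 1) (Measurable.aestronglyMeasurable ?_)
    (Filter.Eventually.of_forall fun lam => ?_)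
  · fun_prop
  · rw [norm_mul, norm_zpow, norm_ofReal_sub_I_div_add_I, one_zpow, mul_one, norm_inv,
      show (lam : ℂ) ^ 2 + 1 = ((lam ^ 2 + 1 : ℝ) : ℂ) by push_cast; rfl,
      Complex.norm_of_nonneg (by positivity)]
    exact inv_le_one_of_one_le₀ (by nlinarith [sq_nonneg lam])

/-- The squared modulus of a trigonometric polynomial in a unimodular `w` is a Toeplitz form. -/
theorem normSq_sum_mul_pow (N : ℕ) (g : ℕ → ℂ) {w : ℂ} (hw : ‖w‖ = 1) :
    ((‖∑ n ∈ Finset.range N, g n * w ^ n‖ ^ 2 : ℝ) : ℂ) =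
      ∑ n ∈ Finset.range N, ∑ m ∈ Finset.range N,
        w ^ (-((n : ℤ) - (m : ℤ))) * g m * (starRingEnd ℂ) (g n) := by
  have hw0 : w ≠ 0 := norm_ne_zero_iff.mp (by simp [hw])
  have hconj : (starRingEnd ℂ) w = w⁻¹ := (Complex.inv_eq_conj hw).symm
  rw [Complex.ofReal_pow, ← Complex.conj_mul', map_sum, Finset.sum_mul_sum]
  refine Finset.sum_congr rfl fun n _ => Finset.sum_congr rfl fun m _ => ?_
  rw [map_mul, map_pow, hconj, neg_sub, zpow_sub₀ hw0, zpow_natCast, zpow_natCast, inv_pow]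
  ring

/-- Under the unitary map sending the standard basis of `ℓ²(ℕ)` to the Laguerre basis
`√2 L_n^0(2x) e^{-x}` of `L²((0,∞))`, the Wiener–Hopf quadratic form of a finite measure
`M` corresponds to the Toeplitz quadratic form with coefficients
`t_k = π⁻¹ ∫ (λ²+1)⁻¹ ((λ-i)/(λ+i))^{-k} dM(λ)`. -/
theorem wienerHopf_form_eq_toeplitz_form_in_laguerre_basis
    (M : Measure ℝ) [IsFiniteMeasure M]
    (N : ℕ) (g : ℕ → ℂ)
    (F : ℝ → ℂ)
    (hF : F = fun x => if 0 < x then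
      (Real.sqrt 2 : ℂ) *
        ∑ n ∈ Finset.range N, g n * (laguerre 0 n (2 * x) : ℂ) * Complex.exp (-x)
      else 0)
    (t : ℤ → ℂ)
    (ht : ∀ k : ℤ, t k = (Real.pi : ℂ)⁻¹ *
      ∫ lam : ℝ, (((lam : ℂ) ^ 2 + 1)⁻¹ *
        (((lam : ℂ) - Complex.I) / ((lam : ℂ) + Complex.I)) ^ (-k)) ∂M) :
    (((2 * Real.pi)⁻¹ *
        ∫ lam : ℝ, ‖∫ x in Ioi (0 : ℝ), Complex.exp (Complex.I * lam * x) * F x‖ ^ 2 ∂M : ℝ) : ℂ) =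
      ∑ n ∈ Finset.range N, ∑ m ∈ Finset.range N,
        t ((n : ℤ) - (m : ℤ)) * g m * (starRingEnd ℂ) (g n) := by
  have hs : ∀ lam : ℝ, ‖(1 - Complex.I * lam : ℂ)⁻¹‖ ^ 2 = (lam ^ 2 + 1)⁻¹ := by
    intro lam
    rw [norm_inv, inv_pow, ← Complex.normSq_eq_norm_sq, Complex.normSq_apply]
    congr 1
    simp
    ring
  have hpt : ∀ lam : ℝ,
      ((‖∫ x in Ioi (0 : ℝ), Complex.exp (Complex.I * lam * x) * F x‖ ^ 2 : ℝ) : ℂ) =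
        ∑ n ∈ Finset.range N, ∑ m ∈ Finset.range N,
          (2 * g m * (starRingEnd ℂ) (g n)) * (((lam : ℂ) ^ 2 + 1)⁻¹ *
            (((lam : ℂ) - Complex.I) / ((lam : ℂ) + Complex.I)) ^ (-((n : ℤ) - (m : ℤ)))) := by
    intro lam
    rw [hF, integral_cexp_mul_laguerre_sum, norm_mul, norm_mul, mul_pow, mul_pow, hs,
      Complex.norm_of_nonneg (Real.sqrt_nonneg 2), Real.sq_sqrt zero_le_two, Complex.ofReal_mul,
      normSq_sum_mul_pow N g (norm_ofReal_sub_I_div_add_I lam), Finset.mul_sum]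
    refine Finset.sum_congr rfl fun n _ => ?_
    rw [Finset.mul_sum]
    refine Finset.sum_congr rfl fun m _ => ?_
    push_cast
    ring
  have hI := fun n m : ℕ => (integrable_inv_sq_add_one_mul_zpow M
    (-((n : ℤ) - (m : ℤ)))).const_mul (2 * g m * (starRingEnd ℂ) (g n))
  rw [Complex.ofReal_mul, ← integral_complex_ofReal, integral_congr_ae (Filter.Eventually.of_forall hpt),
    integral_finsetSum _ fun n _ => integrable_finsetSum _ fun m _ => hI n m, Finset.mul_sum]
  refine Finset.sum_congr rfl fun n _ => ?_
  rw [integral_finsetSum _ fun m _ => hI n m, Finset.mul_sum]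
  refine Finset.sum_congr rfl fun m _ => ?_
  rw [integral_const_mul, ht]
  push_cast
  ring
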